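/- Let A and B be graded-commutative real Poincaré duality algebras of formal dimensions 2n₁ and 2n₂ with classes ω₁ ∈ A², ω₂ ∈ B², and let ω = ω₁⊗1 + 1⊗ω₂ ∈ (A⊗B)². If multiplication by ω₁^{n₁-i} : A^i → A^{2n₁-i} is an isomorphism for all i ≤ s and multiplication by ω₂^{n₂-i} : B^i → B^{2n₂-i} is an isomorphism for all i ≤ s, then multiplication by ω^{n-i} : (A⊗B)^i → (A⊗B)^{2n-i} is an isomorphism for all i ≤ s, where n = n₁ + n₂. -/

import Mathlib

/-- A sequence annihilated by the binomial recursion of order `m` is, up to alternating signs,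
polynomial of degree `< m`; it vanishes if it has at most `j + 1` nonzero terms among the
first `j + m + 1`. -/
theorem eq_zero_of_sum_choose_mul_eq_zero {m j : ℕ} {c : ℕ → ℝ}
    (hc : ∀ p ≤ j, ∑ i ∈ Finset.range (m + 1), (m.choose i : ℝ) * c (p + i) = 0)
    (S : Finset ℕ) (hS : S.card ≤ j + 1) (h0 : ∀ k ≤ j + m, k ∉ S → c k = 0) :
    ∀ k ≤ j + m, c k = 0 := by
  have hinj : ∀ s : Finset ℕ, Set.InjOn (fun k : ℕ => (k : ℝ)) s :=
    fun s => Nat.cast_injective.injOn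
  obtain ⟨Q, hQdeg, hQval⟩ : ∃ Q : Polynomial ℝ, Q.degree < m ∧
      ∀ k < m, Q.eval (k : ℝ) = (-1) ^ k * c k := by
    refine ⟨Lagrange.interpolate (Finset.range m) (fun k : ℕ => (k : ℝ))
      (fun k => (-1) ^ k * c k), ?_, fun k hk => ?_⟩
    · simpa using Lagrange.degree_interpolate_lt
        (r := fun k => (-1) ^ k * c k) (hinj (Finset.range m))
    · exact Lagrange.eval_interpolate_at_node (fun k => (-1) ^ k * c k)
        (hinj (Finset.range m)) (Finset.mem_range.mpr hk)
  have hsq : ∀ k : ℕ, ((-1 : ℝ) ^ k) * (-1) ^ k = 1 := fun k => by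
    rw [← mul_pow]; norm_num
  have hQrec : ∀ p : ℕ, ∑ i ∈ Finset.range (m + 1),
      (m.choose i : ℝ) * ((-1) ^ (p + i) * Q.eval ((p + i : ℕ) : ℝ)) = 0 := by
    intro p
    have hz : (fwdDiff (1 : ℝ))^[m] Q.eval = 0 := by
      rcases eq_or_ne Q 0 with rfl | hQ
      · funext x
        simp [fwdDiff_iter_eq_sum_shift]
      · exact Polynomial.fwdDiff_iter_eq_zero_of_degree_lt
          ((Polynomial.natDegree_lt_iff_degree_lt hQ).2 hQdeg)
    have h := congrFun hz (p : ℝ)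
    rw [fwdDiff_iter_eq_sum_shift] at h
    have h' := congrArg (fun z => (-1 : ℝ) ^ (p + m) * z) h
    simp only [Pi.zero_apply, mul_zero, Finset.mul_sum] at h'
    rw [← h']
    refine Finset.sum_congr rfl fun i hi => ?_
    have hi' : i ≤ m := Nat.lt_succ_iff.mp (Finset.mem_range.mp hi)
    obtain ⟨l, rfl⟩ := Nat.exists_eq_add_of_le hi'
    simp only [zsmul_eq_mul, nsmul_eq_mul, mul_one]
    push_cast
    rw [Nat.add_sub_cancel_left]
    have := hsq l
    linear_combination (-1 : ℝ) ^ (p + i) * ((i + l).choose i : ℝ) *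
      Q.eval ((p : ℝ) + i) * (-this)
  have hcQ : ∀ k ≤ j + m, c k = (-1) ^ k * Q.eval (k : ℝ) := by
    intro k
    induction k using Nat.strong_induction_on with
    | _ k ih =>
      intro hk
      rcases lt_or_ge k m with hkm | hkm
      · rw [hQval k hkm, ← mul_assoc, hsq, one_mul]
      · obtain ⟨p, rfl⟩ := Nat.exists_eq_add_of_le' hkm
        have h1 := hc p (by omega)
        have h2 := hQrec p
        rw [Finset.sum_range_succ] at h1 h2
        have h3 : ∑ i ∈ Finset.range m, (m.choose i : ℝ) * c (p + i) =
            ∑ i ∈ Finset.range m,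
              (m.choose i : ℝ) * ((-1) ^ (p + i) * Q.eval ((p + i : ℕ) : ℝ)) := by
          refine Finset.sum_congr rfl fun i hi => ?_
          have := Finset.mem_range.mp hi
          rw [ih (p + i) (by omega) (by omega)]
        simp only [Nat.choose_self, Nat.cast_one, one_mul] at h1 h2
        linarith
  have hQ0 : Q = 0 := by
    refine Polynomial.eq_zero_of_degree_lt_of_eval_index_eq_zero
      (v := fun k : ℕ => (k : ℝ)) (s := Finset.range (j + m + 1) \ S) (hinj _) (hQdeg.trans_le ?_) fun k hk => ?_
    · have := Finset.le_card_sdiff S (Finset.range (j + m + 1))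
      rw [Finset.card_range] at this
      exact_mod_cast (by omega : m ≤ (Finset.range (j + m + 1) \ S).card)
    · obtain ⟨hk1, hk2⟩ := Finset.mem_sdiff.mp hk
      have hk3 : k ≤ j + m := Nat.lt_succ_iff.mp (Finset.mem_range.mp hk1)
      have h1 := hcQ k hk3
      rw [h0 k hk3 hk2] at h1
      simpa using h1.symm
  intro k hk
  rw [hcQ k hk, hQ0]
  simp

/-- Surjectivity in the hard Lefschetz property of the tensor product of two strings: if
`x ^ (a + 1)` and `y ^ (b + 1)` kill `v`, then every monomial of degree `a + b - j` applied to `v`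
is a combination of `(x + y) ^ (a + b - 2 * j)` applied to the monomials of degree `j`. -/
theorem pow_mul_pow_mul_mem_of_commute {T : Type*} [Ring T] [Algebra ℝ T] {x y v : T}
    (hxy : Commute x y) {a b j : ℕ} (hx : x ^ (a + 1) * v = 0) (hy : y ^ (b + 1) * v = 0)
    (hj : 2 * j ≤ a + b) (N : Submodule ℝ T)
    (hN : ∀ p q, p + q = j → (x + y) ^ (a + b - 2 * j) * (x ^ p * y ^ q * v) ∈ N)
    {r t : ℕ} (hrt : r + t = a + b - j) : x ^ r * y ^ t * v ∈ N := by
  by_contra hmem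
  obtain ⟨φ, hφ, hNφ⟩ := Submodule.exists_le_ker_of_notMem hmem
  obtain ⟨m, hm⟩ : ∃ m, a + b = 2 * j + m := Nat.exists_eq_add_of_le hj
  have hx' : ∀ k, a < k → ∀ l, x ^ k * y ^ l * v = 0 := by
    intro k hk l
    obtain ⟨e, rfl⟩ := Nat.exists_eq_add_of_le' hk
    rw [(hxy.pow_pow _ _).eq, pow_add, mul_assoc, mul_assoc, hx, mul_zero, mul_zero]
  have hy' : ∀ l, b < l → ∀ k, x ^ k * y ^ l * v = 0 := by
    intro l hl k
    obtain ⟨e, rfl⟩ := Nat.exists_eq_add_of_le' hl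
    rw [pow_add, mul_assoc, mul_assoc, hy, mul_zero, mul_zero]
  refine hφ ?_
  have key := eq_zero_of_sum_choose_mul_eq_zero (m := m) (j := j)
    (c := fun k => φ (x ^ k * y ^ (j + m - k) * v)) ?_ (Finset.Icc (a - j) a) ?_ ?_ r (by omega)
  · rwa [show j + m - r = t by omega] at key
  · intro p hp
    have h := LinearMap.mem_ker.mp (hNφ (hN p (j - p) (by omega)))
    rw [show a + b - 2 * j = m by omega, hxy.add_pow, Finset.sum_mul, map_sum] at h
    rw [← h]
    refine Finset.sum_congr rfl fun i hi => ?_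
    have hi' : i ≤ m := Nat.lt_succ_iff.mp (Finset.mem_range.mp hi)
    have hc : x ^ i * y ^ (m - i) * (m.choose i : T) * (x ^ p * y ^ (j - p) * v) =
        (m.choose i : ℝ) • (x ^ (p + i) * y ^ (j + m - (p + i)) * v) := by
      rw [Algebra.smul_def, map_natCast, ← (Nat.cast_commute (m.choose i) _).eq,
        show j + m - (p + i) = (m - i) + (j - p) by omega, add_comm p i, pow_add, pow_add]
      have := (hxy.pow_pow p (m - i)).eq
      simp only [mul_assoc]
      rw [← mul_assoc (y ^ (m - i)) (x ^ p), ← this]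
      simp only [mul_assoc]
    rw [hc, map_smul, smul_eq_mul]
  · rw [Nat.card_Icc]
    omega
  · intro k hk hkS
    rw [Finset.mem_Icc] at hkS
    rcases lt_or_ge a k with h | h
    · simp [hx' k h]
    · simp [hy' (j + m - k) (by omega) k]

/-- The degree-`p` part of the span of the Lefschetz strings `ω ^ r * x`, with `x` primitive. -/
def lefschetzSpan {A : Type*} [Ring A] [Algebra ℝ A] (𝒜 : ℕ → Submodule ℝ A) (n : ℕ) (ω : A)
    (p : ℕ) : Submodule ℝ A :=
  Submodule.span ℝ {z | ∃ k r : ℕ, ∃ x ∈ 𝒜 k, k ≤ n ∧ k + 2 * r = p ∧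
    ω ^ (n - k + 1) * x = 0 ∧ z = ω ^ r * x}

theorem pow_mul_mem_lefschetzSpan {A : Type*} [Ring A] [Algebra ℝ A] {𝒜 : ℕ → Submodule ℝ A}
    {n : ℕ} {ω : A} {p : ℕ} {a : A} (ha : a ∈ lefschetzSpan 𝒜 n ω p) (e : ℕ) :
    ω ^ e * a ∈ lefschetzSpan 𝒜 n ω (p + 2 * e) := by
  have hle : lefschetzSpan 𝒜 n ω p ≤
      (lefschetzSpan 𝒜 n ω (p + 2 * e)).comap (LinearMap.mulLeft ℝ (ω ^ e)) := by
    refine Submodule.span_le.mpr ?_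
    rintro _ ⟨k, r, x, hx, hk, hp, hprim, rfl⟩
    refine Submodule.subset_span ⟨k, e + r, x, hx, hk, by omega, hprim, ?_⟩
    rw [LinearMap.mulLeft_apply, ← mul_assoc, pow_add]
  exact hle ha

theorem pow_mul_mem_graded {A : Type*} [Ring A] [Algebra ℝ A] (𝒜 : ℕ → Submodule ℝ A)
    [GradedRing 𝒜] {ω : A} (hω : ω ∈ 𝒜 2) {k : ℕ} {a : A} (ha : a ∈ 𝒜 k) (r : ℕ) :
    ω ^ r * a ∈ 𝒜 (k + 2 * r) := by
  have h := SetLike.mul_mem_graded (SetLike.pow_mem_graded r hω) ha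
  rwa [smul_eq_mul, show r * 2 + k = k + 2 * r by ring] at h

theorem mem_lefschetzSpan_of_le {A : Type*} [Ring A] [Algebra ℝ A] (𝒜 : ℕ → Submodule ℝ A)
    [GradedRing 𝒜] {n s : ℕ} {ω : A} (hω : ω ∈ 𝒜 2) (htop : ∀ k, 2 * n < k → 𝒜 k = ⊥)
    (hL : ∀ i ≤ s, ∀ b ∈ 𝒜 (2 * n - i), ∃ a ∈ 𝒜 i, ω ^ (n - i) * a = b)
    {p : ℕ} (hps : p ≤ s) (hpn : p ≤ n) {a : A} (ha : a ∈ 𝒜 p) : a ∈ lefschetzSpan 𝒜 n ω p := by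
  induction p using Nat.strong_induction_on generalizing a with
  | _ p ih =>
    have hdeg := pow_mul_mem_graded 𝒜 hω ha (n - p + 1)
    rcases lt_or_ge p 2 with hp | hp
    · rw [htop _ (by omega), Submodule.mem_bot] at hdeg
      exact Submodule.subset_span ⟨p, 0, a, ha, hpn, by omega, hdeg, by simp⟩
    · obtain ⟨q, rfl⟩ := Nat.exists_eq_add_of_le' hp
      rw [show q + 2 + 2 * (n - (q + 2) + 1) = 2 * n - q by omega] at hdeg
      obtain ⟨c, hc, hca⟩ := hL q (by omega) _ hdeg
      have hωc : ω * c ∈ 𝒜 (q + 2) := by simpa using pow_mul_mem_graded 𝒜 hω hc 1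
      have hprim : ω ^ (n - (q + 2) + 1) * (a - ω * c) = 0 := by
        rw [mul_sub, ← hca, ← mul_assoc, ← pow_succ,
          show n - (q + 2) + 1 + 1 = n - q by omega, sub_self]
      have h1 : a - ω * c ∈ lefschetzSpan 𝒜 n ω (q + 2) :=
        Submodule.subset_span ⟨q + 2, 0, _, sub_mem ha hωc, hpn, by omega, hprim, by simp⟩
      have h2 : ω * c ∈ lefschetzSpan 𝒜 n ω (q + 2) := by
        simpa using pow_mul_mem_lefschetzSpan (ih q (by omega) (by omega) (by omega) hc) 1
      simpa using add_mem h1 h2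

/-- In an `s`-Lefschetz algebra the elements of degree at least `2 * n - s` are combinations of
Lefschetz strings. -/
theorem mem_lefschetzSpan_of_ge {A : Type*} [Ring A] [Algebra ℝ A] (𝒜 : ℕ → Submodule ℝ A)
    [GradedRing 𝒜] {n s : ℕ} {ω : A} (hω : ω ∈ 𝒜 2) (htop : ∀ k, 2 * n < k → 𝒜 k = ⊥)
    (hL : ∀ i ≤ s, ∀ b ∈ 𝒜 (2 * n - i), ∃ a ∈ 𝒜 i, ω ^ (n - i) * a = b)
    {p : ℕ} (hps : 2 * n ≤ p + s) (hpn : p ≤ 2 * n) {a : A} (ha : a ∈ 𝒜 p) :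
    a ∈ lefschetzSpan 𝒜 n ω p := by
  rcases le_total p n with h | h
  · exact mem_lefschetzSpan_of_le 𝒜 hω htop hL (by omega) h ha
  · obtain ⟨c, hc, rfl⟩ := hL (2 * n - p) (by omega) a
      (by rwa [show 2 * n - (2 * n - p) = p by omega])
    have := pow_mul_mem_lefschetzSpan
      (mem_lefschetzSpan_of_le 𝒜 hω htop hL (by omega) (by omega) hc) (n - (2 * n - p))
    rwa [show 2 * n - p + 2 * (n - (2 * n - p)) = p by omega] at this

theorem even_commute_of_graded_commute {A C : Type*} [Ring A] [Algebra ℝ A] [Ring C] [Algebra ℝ C]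
    (𝒜 : ℕ → Submodule ℝ A) [GradedRing 𝒜] (f : A →ₐ[ℝ] C) {c : C}
    (h : ∀ i, ∀ a ∈ 𝒜 i, c * f a = ((-1 : ℝ) ^ (i * 2)) • (f a * c)) (a : A) :
    Commute c (f a) := by
  induction a using DirectSum.Decomposition.inductionOn 𝒜 with
  | zero => simp
  | homogeneous m =>
    rename_i i
    have := h i m m.2
    rwa [mul_comm i 2, pow_mul, neg_one_sq, one_pow, one_smul] at this
  | add a b ha hb => rw [map_add]; exact ha.add_right hb

/-- An orientation of a Poincaré duality algebra: a functional supported in top degree whose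
associated pairing is nondegenerate. -/
theorem exists_orientation {A : Type*} [Ring A] [Algebra ℝ A] (𝒜 : ℕ → Submodule ℝ A)
    [GradedRing 𝒜] {N : ℕ} (htop : ∀ k, N < k → 𝒜 k = ⊥)
    (hdim : Module.finrank ℝ (𝒜 N) = 1)
    (hnd : ∀ k, k ≤ N → ∀ a ∈ 𝒜 k, (∀ b ∈ 𝒜 (N - k), a * b = 0) → a = 0) :
    ∃ I : A →ₗ[ℝ] ℝ, (∀ k, k ≠ N → ∀ a ∈ 𝒜 k, I a = 0) ∧
      ∀ a, (∀ b, I (a * b) = 0) → a = 0 := by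
  classical
  have : FiniteDimensional ℝ (𝒜 N) := Module.finite_of_finrank_eq_succ hdim
  let ε : 𝒜 N ≃ₗ[ℝ] ℝ := LinearEquiv.ofFinrankEq _ _ (by rw [hdim, Module.finrank_self])
  let I : A →ₗ[ℝ] ℝ := ε.toLinearMap ∘ₗ DirectSum.component ℝ ℕ (fun i => 𝒜 i) N ∘ₗ
    (DirectSum.decomposeLinearEquiv 𝒜).toLinearMap
  have hI : ∀ a, I a = ε (DirectSum.decompose 𝒜 a N) := fun a => rfl
  have hI0 : ∀ k, k ≠ N → ∀ a ∈ 𝒜 k, I a = 0 := by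
    intro k hk a ha
    have : DirectSum.decompose 𝒜 a N = 0 :=
      Subtype.ext (DirectSum.decompose_of_mem_ne 𝒜 ha hk)
    rw [hI, this, map_zero]
  have hIN : ∀ a ∈ 𝒜 N, I a = 0 → a = 0 := by
    intro a ha h
    rw [hI, LinearEquiv.map_eq_zero_iff] at h
    rw [← DirectSum.decompose_of_mem_same 𝒜 ha, h]
    rfl
  refine ⟨I, hI0, fun a ha => ?_⟩
  rw [← DirectSum.sum_support_decompose 𝒜 a]
  refine Finset.sum_eq_zero fun k _ => ?_
  rcases lt_or_ge N k with hk | hk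
  · exact (Submodule.mem_bot ℝ).mp ((htop k hk).le (DirectSum.decompose 𝒜 a k).2)
  · refine hnd k hk _ (DirectSum.decompose 𝒜 a k).2 fun b hb => ?_
    have hmul : ∀ i, (DirectSum.decompose 𝒜 a i : A) * b ∈ 𝒜 (i + (N - k)) := fun i =>
      SetLike.mul_mem_graded (DirectSum.decompose 𝒜 a i).2 hb
    refine hIN _ (by simpa [Nat.add_sub_cancel' hk] using hmul k) ?_
    have h := ha b
    rw [← DirectSum.sum_support_decompose 𝒜 a, Finset.sum_mul, map_sum] at h
    rw [← h, eq_comm]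
    refine Finset.sum_eq_single k (fun i _ hik => hI0 _ (by omega) _ (hmul i)) fun hk' => ?_
    rw [DFinsupp.notMem_support_iff.mp hk']
    simp

/-- The pairing `⟨a ⊗ b, c ⊗ d⟩ = I (a * c) * J (b * d)` transported to `T ≃ A ⊗ B`. -/
theorem exists_tensor_pairing {A B T : Type*} [Ring A] [Algebra ℝ A] [Ring B] [Algebra ℝ B]
    [AddCommGroup T] [Module ℝ T] [FiniteDimensional ℝ A] [FiniteDimensional ℝ B]
    (e : TensorProduct ℝ A B ≃ₗ[ℝ] T) (I : A →ₗ[ℝ] ℝ) (J : B →ₗ[ℝ] ℝ)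
    (hI : ∀ a, (∀ b, I (a * b) = 0) → a = 0) (hJ : ∀ a, (∀ b, J (a * b) = 0) → a = 0) :
    ∃ β : T →ₗ[ℝ] T →ₗ[ℝ] ℝ, (∀ a b a' b', β (e (a ⊗ₜ b)) (e (a' ⊗ₜ b')) =
      I (a * a') * J (b * b')) ∧ ∀ t, (∀ u, β t u = 0) → t = 0 := by
  let P : A →ₗ[ℝ] Module.Dual ℝ A := (LinearMap.mul ℝ A).compr₂ I
  let Q : B →ₗ[ℝ] Module.Dual ℝ B := (LinearMap.mul ℝ B).compr₂ J
  have hP : Function.Injective P := (injective_iff_map_eq_zero P).mpr fun a ha =>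
    hI a fun b => LinearMap.congr_fun ha b
  have hQ : Function.Injective Q := (injective_iff_map_eq_zero Q).mpr fun a ha =>
    hJ a fun b => LinearMap.congr_fun ha b
  let Ψ : TensorProduct ℝ A B →ₗ[ℝ] Module.Dual ℝ (TensorProduct ℝ A B) :=
    (TensorProduct.dualDistribEquiv ℝ A B).toLinearMap ∘ₗ TensorProduct.map P Q
  have hΨ : Function.Injective Ψ :=
    (TensorProduct.dualDistribEquiv ℝ A B).injective.comp
      (TensorProduct.map_injective_of_flat_flat P Q hP hQ)
  refine ⟨(Ψ ∘ₗ e.symm.toLinearMap).compl₂ e.symm.toLinearMap, fun a b a' b' => ?_,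
    fun t ht => ?_⟩
  · simp only [LinearMap.compl₂_apply, LinearMap.comp_apply, LinearEquiv.coe_coe,
      LinearEquiv.symm_apply_apply]
    rfl
  · have h : Ψ (e.symm t) = 0 := by
      ext1
      refine LinearMap.ext fun a => LinearMap.ext fun b => ?_
      simpa using ht (e (a ⊗ₜ b))
    simpa using hΨ (h.trans (map_zero Ψ).symm)

theorem degree_le_of_lefschetz {A : Type*} [Ring A] [Algebra ℝ A] (𝒜 : ℕ → Submodule ℝ A)
    [GradedRing 𝒜] {n s : ℕ} {ω : A} (htop : ∀ k, 2 * n < k → 𝒜 k = ⊥)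
    (hdim : Module.finrank ℝ (𝒜 (2 * n)) = 1)
    (hL : ∀ i ≤ s, ∀ b ∈ 𝒜 (2 * n - i), ∃ a ∈ 𝒜 i, ω ^ (n - i) * a = b) : s ≤ 2 * n := by
  by_contra! hs
  obtain ⟨a, ha, h⟩ := hL s le_rfl 1 (by
    rw [Nat.sub_eq_zero_of_le hs.le]; exact SetLike.GradedOne.one_mem)
  rw [htop s hs, Submodule.mem_bot] at ha
  rw [ha, mul_zero] at h
  have : Subsingleton A := subsingleton_of_zero_eq_one h
  rw [Module.finrank_zero_of_subsingleton] at hdim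
  exact zero_ne_one hdim

/-- If `A`, `B` are graded-commutative real Poincaré duality
algebras of formal dimensions `2n₁`, `2n₂` with classes `ω₁ ∈ A²`, `ω₂ ∈ B²`,
and `T` realises the graded tensor product `A ⊗ B` (via graded algebra maps
`f, g` with the Koszul commutation rule, whose induced map `A ⊗ B → T` is a
linear bijection), and if `(A, ω₁)` and `(B, ω₂)` are both `s`-Lefschetz
(multiplication by `ωⱼ^{nⱼ-i}` is an isomorphism in degrees `i ≤ s`), then
`(T, ω = ω₁⊗1 + 1⊗ω₂)` is `s`-Lefschetz: multiplication by `ω^{n-i}` is an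
isomorphism `(A⊗B)^i → (A⊗B)^{2n-i}` for all `i ≤ s`, where `n = n₁ + n₂`. -/
theorem stmt3 {A B T : Type*} [Ring A] [Algebra ℝ A] [Ring B] [Algebra ℝ B]
    [Ring T] [Algebra ℝ T]
    [FiniteDimensional ℝ A] [FiniteDimensional ℝ B]
    (𝒜 : ℕ → Submodule ℝ A) (ℬ : ℕ → Submodule ℝ B) (𝒯 : ℕ → Submodule ℝ T)
    [GradedRing 𝒜] [GradedRing ℬ] [GradedRing 𝒯]
    (n₁ n₂ : ℕ) (ω₁ : A) (ω₂ : B) (hω₁ : ω₁ ∈ 𝒜 2) (hω₂ : ω₂ ∈ ℬ 2)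
    -- Poincaré duality algebra structure on A
    (htopA : ∀ k, 2 * n₁ < k → 𝒜 k = ⊥)
    (hcommA : ∀ i j : ℕ, ∀ a ∈ 𝒜 i, ∀ b ∈ 𝒜 j,
      a * b = ((-1 : ℝ) ^ (i * j)) • (b * a))
    (hdimA : Module.finrank ℝ (𝒜 (2 * n₁)) = 1)
    (hndA : ∀ k, k ≤ 2 * n₁ → ∀ a ∈ 𝒜 k,
      (∀ b ∈ 𝒜 (2 * n₁ - k), a * b = 0) → a = 0)
    -- Poincaré duality algebra structure on B
    (htopB : ∀ k, 2 * n₂ < k → ℬ k = ⊥)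
    (hcommB : ∀ i j : ℕ, ∀ a ∈ ℬ i, ∀ b ∈ ℬ j,
      a * b = ((-1 : ℝ) ^ (i * j)) • (b * a))
    (hdimB : Module.finrank ℝ (ℬ (2 * n₂)) = 1)
    (hndB : ∀ k, k ≤ 2 * n₂ → ∀ a ∈ ℬ k,
      (∀ b ∈ ℬ (2 * n₂ - k), a * b = 0) → a = 0)
    -- T is the graded tensor product of A and B
    (f : A →ₐ[ℝ] T) (g : B →ₐ[ℝ] T)
    (hf : ∀ i, ∀ a ∈ 𝒜 i, f a ∈ 𝒯 i) (hg : ∀ j, ∀ b ∈ ℬ j, g b ∈ 𝒯 j)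
    (hkoszul : ∀ i j : ℕ, ∀ a ∈ 𝒜 i, ∀ b ∈ ℬ j,
      g b * f a = ((-1 : ℝ) ^ (i * j)) • (f a * g b))
    (htens : Function.Bijective
      (TensorProduct.lift ((LinearMap.mul ℝ T).compl₁₂ f.toLinearMap g.toLinearMap)))
    (hspan : ∀ k, 𝒯 k = ⨆ p : {p : ℕ × ℕ // p.1 + p.2 = k},
      Submodule.span ℝ {z | ∃ a ∈ 𝒜 p.1.1, ∃ b ∈ ℬ p.1.2, z = f a * g b})
    -- the s-Lefschetz hypotheses on A and B
    (s : ℕ)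
    (hLA : ∀ i, i ≤ s →
      (∀ a ∈ 𝒜 i, ω₁ ^ (n₁ - i) * a = 0 → a = 0) ∧
      (∀ b ∈ 𝒜 (2 * n₁ - i), ∃ a ∈ 𝒜 i, ω₁ ^ (n₁ - i) * a = b))
    (hLB : ∀ i, i ≤ s →
      (∀ a ∈ ℬ i, ω₂ ^ (n₂ - i) * a = 0 → a = 0) ∧
      (∀ b ∈ ℬ (2 * n₂ - i), ∃ a ∈ ℬ i, ω₂ ^ (n₂ - i) * a = b)) :
    ∀ i, i ≤ s →
      (∀ t ∈ 𝒯 i, (f ω₁ + g ω₂) ^ (n₁ + n₂ - i) * t = 0 → t = 0) ∧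
      (∀ u ∈ 𝒯 (2 * (n₁ + n₂) - i), ∃ t ∈ 𝒯 i,
        (f ω₁ + g ω₂) ^ (n₁ + n₂ - i) * t = u) := by
  have hLA' := fun i hi => (hLA i hi).2
  have hLB' := fun i hi => (hLB i hi).2
  have hsA := degree_le_of_lefschetz 𝒜 htopA hdimA hLA'
  have hsB := degree_le_of_lefschetz ℬ htopB hdimB hLB'
  have hcomm : ∀ a, Commute (g ω₂) (f a) := even_commute_of_graded_commute 𝒜 f
    fun i a ha => hkoszul i 2 a ha ω₂ hω₂
  have hcentA : ∀ a, Commute ω₁ a := even_commute_of_graded_commute 𝒜 (AlgHom.id ℝ A)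
    fun i a ha => by rw [mul_comm i 2]; exact hcommA 2 i ω₁ hω₁ a ha
  have hcentB : ∀ b, Commute ω₂ b := even_commute_of_graded_commute ℬ (AlgHom.id ℝ B)
    fun i b hb => by rw [mul_comm i 2]; exact hcommB 2 i ω₂ hω₂ b hb
  set ω : T := f ω₁ + g ω₂ with hω
  have hωmul : ∀ a b, ω * (f a * g b) = f (ω₁ * a) * g b + f a * g (ω₂ * b) := by
    intro a b
    rw [hω, add_mul, map_mul, map_mul, ← mul_assoc, ← mul_assoc (g ω₂), (hcomm a).eq]
    simp only [mul_assoc]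
  have hmono : ∀ r t x y, f (ω₁ ^ r * x) * g (ω₂ ^ t * y) =
      f ω₁ ^ r * g ω₂ ^ t * (f x * g y) := by
    intro r t x y
    have := ((hcomm x).pow_left t).eq
    simp only [map_mul, map_pow, mul_assoc]
    rw [← mul_assoc (g ω₂ ^ t) (f x), this, mul_assoc]
  intro i hi
  have hin : i ≤ n₁ + n₂ := by omega
  have hsurj : ∀ u ∈ 𝒯 (2 * (n₁ + n₂) - i), ∃ t ∈ 𝒯 i, ω ^ (n₁ + n₂ - i) * t = u := by
    let N : Submodule ℝ T := (𝒯 i).map (LinearMap.mulLeft ℝ (ω ^ (n₁ + n₂ - i)))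
    suffices h : 𝒯 (2 * (n₁ + n₂) - i) ≤ N from fun u hu => h hu
    have hstring : ∀ k l r t x y, x ∈ 𝒜 k → y ∈ ℬ l → k ≤ n₁ → l ≤ n₂ →
        ω₁ ^ (n₁ - k + 1) * x = 0 → ω₂ ^ (n₂ - l + 1) * y = 0 →
        k + 2 * r + (l + 2 * t) = 2 * (n₁ + n₂) - i →
        f (ω₁ ^ r * x) * g (ω₂ ^ t * y) ∈ N := by
      intro k l r t x y hx hy hk hl hpx hpy hdeg
      rcases lt_or_ge i (k + l) with hikl | hikl
      · suffices h : f (ω₁ ^ r * x) * g (ω₂ ^ t * y) = 0 by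
          rw [h]; exact zero_mem _
        rcases lt_or_ge (n₁ - k) r with hr | hr
        · obtain ⟨d, rfl⟩ := Nat.exists_eq_add_of_le' hr
          rw [pow_add, mul_assoc, hpx, mul_zero, map_zero, zero_mul]
        · obtain ⟨d, rfl⟩ := Nat.exists_eq_add_of_le' (by omega : n₂ - l + 1 ≤ t)
          rw [pow_add (ω₂), mul_assoc, hpy, mul_zero, map_zero, mul_zero]
      · obtain ⟨j, hj⟩ : ∃ j, i = k + l + 2 * j := ⟨(i - k - l) / 2, by omega⟩
        rw [hmono]
        refine pow_mul_pow_mul_mem_of_commute (hcomm ω₁).symm (a := n₁ - k) (b := n₂ - l) (j := j)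
          ?_ ?_ (by omega) N (fun p q hpq => ?_) (by omega)
        · rw [← mul_assoc, ← map_pow, ← map_mul, hpx, map_zero, zero_mul]
        · rw [← mul_assoc, ((hcomm x).pow_left _).eq, mul_assoc, ← map_pow, ← map_mul, hpy,
            map_zero, mul_zero]
        · rw [show n₁ - k + (n₂ - l) - 2 * j = n₁ + n₂ - i by omega]
          refine Submodule.mem_map_of_mem ?_
          rw [← hmono]
          have := SetLike.mul_mem_graded (hf _ _ (pow_mul_mem_graded 𝒜 hω₁ hx p))
            (hg _ _ (pow_mul_mem_graded ℬ hω₂ hy q))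
          rwa [show k + 2 * p + (l + 2 * q) = i by omega] at this
    rw [hspan]
    refine iSup_le ?_
    rintro ⟨⟨p, q⟩, hpq⟩
    refine Submodule.span_le.mpr ?_
    rintro _ ⟨a, ha, b, hb, rfl⟩
    simp only at hpq ha hb
    rcases lt_or_ge (2 * n₁) p with hp | hp
    · rw [htopA p hp, Submodule.mem_bot] at ha
      simp [ha]
    rcases lt_or_ge (2 * n₂) q with hq | hq
    · rw [htopB q hq, Submodule.mem_bot] at hb
      simp [hb]
    have ha' := mem_lefschetzSpan_of_ge 𝒜 hω₁ htopA hLA' (by omega) hp ha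
    have hb' := mem_lefschetzSpan_of_ge ℬ hω₂ htopB hLB' (by omega) hq hb
    have hmem := Submodule.apply_mem_map₂
      ((LinearMap.mul ℝ T).compl₁₂ f.toLinearMap g.toLinearMap) ha' hb'
    refine (?_ : Submodule.map₂ _ _ _ ≤ N) hmem
    rw [lefschetzSpan, lefschetzSpan, Submodule.map₂_span_span]
    refine Submodule.span_le.mpr ?_
    rintro _ ⟨_, ⟨k, r, x, hx, hk, hkp, hpx, rfl⟩, _, ⟨l, t, y, hy, hl, hlq, hpy, rfl⟩, rfl⟩
    exact hstring k l r t x y hx hy hk hl hpx hpy (by omega)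
  refine ⟨fun t ht h0 => ?_, hsurj⟩
  obtain ⟨I, hI, hIA⟩ := exists_orientation 𝒜 htopA hdimA hndA
  obtain ⟨J, hJ, hJB⟩ := exists_orientation ℬ htopB hdimB hndB
  let e := LinearEquiv.ofBijective _ htens
  have he : ∀ a b, e (a ⊗ₜ b) = f a * g b := fun a b => rfl
  obtain ⟨β, hβ, hβnd⟩ := exists_tensor_pairing e I J hIA hJB
  simp only [he] at hβ
  have hβω : ∀ t u, β (ω * t) u = β t (ω * u) := by
    suffices h : β ∘ₗ LinearMap.mulLeft ℝ ω = β.compl₂ (LinearMap.mulLeft ℝ ω) from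
      fun t u => LinearMap.congr_fun (LinearMap.congr_fun h t) u
    have hgen : ∀ a b a' b', β (ω * (f a * g b)) (f a' * g b') =
        β (f a * g b) (ω * (f a' * g b')) := by
      intro a b a' b'
      simp only [hωmul, map_add, LinearMap.add_apply, hβ]
      rw [(hcentA a).eq, (hcentB b).eq, mul_assoc, mul_assoc]
    refine LinearMap.ext fun t => LinearMap.ext fun u => ?_
    obtain ⟨t, rfl⟩ := e.surjective t
    obtain ⟨u, rfl⟩ := e.surjective u
    simp only [LinearMap.comp_apply, LinearMap.compl₂_apply, LinearMap.mulLeft_apply]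
    induction t using TensorProduct.induction_on with
    | zero => simp
    | add t t' h h' => simp only [map_add, mul_add, LinearMap.add_apply, h, h']
    | tmul a b =>
      induction u using TensorProduct.induction_on with
      | zero => simp
      | add u u' h h' => simp only [map_add, mul_add, h, h']
      | tmul a' b' => exact hgen a b a' b'
  have hβpow : ∀ m t u, β (ω ^ m * t) u = β t (ω ^ m * u) := by
    intro m
    induction m with
    | zero => simp
    | succ m ih =>
      intro t u
      rw [pow_succ, mul_assoc, ih, hβω, ← mul_assoc, ← pow_succ', pow_succ]
  have hβdeg : ∀ k l, k + l ≠ 2 * (n₁ + n₂) → ∀ t ∈ 𝒯 k, ∀ u ∈ 𝒯 l, β t u = 0 := by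
    intro k l hkl t ht u hu
    have hu' : 𝒯 k ≤ LinearMap.ker (β.flip u) := by
      rw [hspan k]
      refine iSup_le ?_
      rintro ⟨⟨p, q⟩, hpq⟩
      refine Submodule.span_le.mpr ?_
      rintro _ ⟨a, ha, b, hb, rfl⟩
      have ht' : 𝒯 l ≤ LinearMap.ker (β (f a * g b)) := by
        rw [hspan l]
        refine iSup_le ?_
        rintro ⟨⟨p', q'⟩, hpq'⟩
        refine Submodule.span_le.mpr ?_
        rintro _ ⟨a', ha', b', hb', rfl⟩
        simp only at hpq hpq' ha hb ha' hb'
        rw [SetLike.mem_coe, LinearMap.mem_ker, hβ]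
        by_cases hp : p + p' = 2 * n₁
        · rw [hJ (q + q') (by omega) _ (SetLike.mul_mem_graded hb hb'), mul_zero]
        · rw [hI (p + p') hp _ (SetLike.mul_mem_graded ha ha'), zero_mul]
      exact ht' hu
    exact hu' ht
  refine hβnd t fun u => ?_
  induction u using DirectSum.Decomposition.inductionOn 𝒯 with
  | zero => simp
  | add u u' h h' => rw [map_add, h, h', add_zero]
  | homogeneous u =>
    rename_i l
    by_cases hl : i + l = 2 * (n₁ + n₂)
    · obtain ⟨t', -, ht'⟩ := hsurj u (by
        rw [show 2 * (n₁ + n₂) - i = l by omega]; exact u.2)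
      rw [← ht', ← hβpow, h0, map_zero, LinearMap.zero_apply]
    · exact hβdeg i l hl t ht u u.2
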